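/- With G(x) = g_n(k|x|) Y_n^m(x/|x|) where g_n satisfies the spherical Bessel recurrences, ∂_{x_1} G(x) = (k/2)[ g_{n-1}(kr)( a_{n-1}^{m+1} Y_{n-1}^{m+1} − b_{n-1}^{m-1} Y_{n-1}^{m-1} ) + g_{n+1}(kr)( c_{n+1}^{m+1} Y_{n+1}^{m+1} − d_{n+1}^{m-1} Y_{n+1}^{m-1} ) ], where a_{n-1}^{m+1} = sqrt((n−m)(n−m−1)/((2n+1)(2n−1))), b_{n-1}^{m-1} = sqrt((n+m)(n+m−1)/((2n+1)(2n−1))), c_{n+1}^{m+1} = sqrt((n+m+2)(n+m+1)/((2n+1)(2n+3))), d_{n+1}^{m-1} = sqrt((n−m+2)(n−m+1)/((2n+1)(2n+3))). -/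

import Mathlib

open Real

/-- Legendre polynomial of degree `n` (Rodrigues formula). -/
noncomputable def legendreP (n : ℕ) (z : ℝ) : ℝ :=
  (1 / (2 ^ n * (Nat.factorial n : ℝ))) *
    iteratedDeriv n (fun x : ℝ => (x ^ 2 - 1) ^ n) z

/-- Associated Legendre function for `0 ≤ m ≤ n` (Condon–Shortley convention). -/
noncomputable def assocLegendreNat (n m : ℕ) (z : ℝ) : ℝ :=
  (-1 : ℝ) ^ m * (1 - z ^ 2) ^ ((m : ℝ) / 2) * iteratedDeriv m (legendreP n) z

/-- Associated Legendre function with integer degree and order, extended to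
negative orders by `P_n^{-m} = (-1)^m ((n-m)!/(n+m)!) P_n^m`, and taken to be
zero when the order exceeds the degree or the degree is negative. -/
noncomputable def assocLegendre (n m : ℤ) (z : ℝ) : ℝ :=
  if 0 ≤ n ∧ |m| ≤ n then
    if 0 ≤ m then assocLegendreNat n.toNat m.toNat z
    else (-1 : ℝ) ^ (-m).toNat *
      ((Nat.factorial (n + m).toNat : ℝ) / (Nat.factorial (n - m).toNat : ℝ)) *
      assocLegendreNat n.toNat (-m).toNat z
  else 0

/-- Normalization constant `γ_n^m = sqrt((2n+1)(n-m)!/(4π(n+m)!))`. -/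
noncomputable def sphGamma (n m : ℤ) : ℝ :=
  Real.sqrt ((2 * (n : ℝ) + 1) * (Nat.factorial (n - m).toNat : ℝ) /
    (4 * Real.pi * (Nat.factorial (n + m).toNat : ℝ)))

/-- Orthonormal spherical harmonic `Y_n^m(θ,φ) = γ_n^m e^{imφ} P_n^m(cos θ)`. -/
noncomputable def sphHarm (n m : ℤ) (θ φ : ℝ) : ℂ :=
  (sphGamma n m : ℂ) * Complex.exp (Complex.I * (m : ℂ) * (φ : ℂ)) *
    ((assocLegendre n m (Real.cos θ) : ℝ) : ℂ)

/-- `G(x) = g_n(k|x|) Y_n^m(x/|x|)`, with the angular spherical coordinates of `x`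
recovered as `θ = arccos(x₃/|x|)` and `φ = arg(x₁ + i x₂)`. -/
noncomputable def sphG (g : ℤ → ℝ → ℂ) (k : ℝ) (n m : ℤ)
    (x : EuclideanSpace ℝ (Fin 3)) : ℂ :=
  g n (k * ‖x‖) *
    sphHarm n m (Real.arccos (x 2 / ‖x‖)) (Complex.arg ((x 0 : ℂ) + (x 1 : ℂ) * Complex.I))

open Polynomial in
/-- Unnormalised Rodrigues polynomial. -/
noncomputable def rodU (n : ℕ) : ℝ[X] := C (1 / (2 ^ n * (Nat.factorial n : ℝ))) * (X ^ 2 - 1) ^ n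

open Polynomial in
/-- Legendre polynomial as a polynomial. -/
noncomputable def legPoly (n : ℕ) : ℝ[X] := derivative^[n] (rodU n)

open Polynomial in
lemma C_two_eq : (C 2 : ℝ[X]) = 2 := map_ofNat C 2

open Polynomial in
lemma iter_comm (p : ℝ[X]) (m : ℕ) : derivative^[m] (derivative p) = derivative (derivative^[m] p) := by
  rw [← Function.iterate_succ_apply, Function.iterate_succ_apply']

open Polynomial in
lemma iter_X_mul (p : ℝ[X]) (n : ℕ) :
    derivative^[n + 1] (X * p) = X * derivative^[n + 1] p + ((n : ℝ[X]) + 1) * derivative^[n] p := by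
  induction n with
  | zero => simp; ring
  | succ n ih =>
    rw [Function.iterate_succ_apply', ih]
    simp only [derivative_add, derivative_mul, derivative_X, derivative_natCast, derivative_one,
      ← Function.iterate_succ_apply' (derivative (R := ℝ))]
    push_cast
    ring

open Polynomial in
lemma iter_W_mul (p : ℝ[X]) (n : ℕ) :
    derivative^[n + 2] ((X ^ 2 - 1) * p) = (X ^ 2 - 1) * derivative^[n + 2] p
      + 2 * ((n : ℝ[X]) + 2) * X * derivative^[n + 1] p
      + ((n : ℝ[X]) + 2) * ((n : ℝ[X]) + 1) * derivative^[n] p := by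
  induction n with
  | zero =>
    simp [Function.iterate_succ_apply', derivative_mul]
    ring
  | succ n ih =>
    rw [Function.iterate_succ_apply', ih]
    simp only [derivative_add, derivative_sub, derivative_mul, derivative_X, derivative_X_pow, derivative_natCast,
      derivative_one, derivative_ofNat,
      ← Function.iterate_succ_apply' (derivative (R := ℝ))]
    push_cast
    simp only [Nat.add_one_sub_one, Nat.cast_ofNat, map_ofNat, pow_one, sub_zero, zero_mul, zero_add, add_zero, mul_one, one_mul, mul_zero]
    simp
    try simp only [C_two_eq]
    ring

open Polynomial in
lemma rodU_deriv (n : ℕ) : derivative (rodU (n + 1)) = X * rodU n := by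
  have h : ((n : ℝ) + 1) ≠ 0 := by positivity
  have hf : (Nat.factorial n : ℝ) ≠ 0 := by positivity
  have : (1 / (2 ^ (n + 1) * (Nat.factorial (n + 1) : ℝ))) * (2 * ((n : ℝ) + 1)) =
      1 / (2 ^ n * (Nat.factorial n : ℝ)) := by
    rw [Nat.factorial_succ]; push_cast; rw [pow_succ]; field_simp
  unfold rodU
  rw [← this]
  simp only [derivative_mul, derivative_C, derivative_pow, derivative_sub, derivative_X, derivative_one, C_mul, C_add, map_ofNat, map_natCast, C_1]
  simp
  ring

open Polynomial in
lemma rodU_ode (n : ℕ) : (X ^ 2 - 1) * derivative (rodU n) = 2 * (n : ℝ[X]) * X * rodU n := by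
  cases n with
  | zero => simp [rodU]
  | succ n =>
    unfold rodU
    simp only [derivative_mul, derivative_C, derivative_pow, derivative_sub, derivative_X, derivative_one]
    simp only [Nat.add_one_sub_one, Nat.cast_ofNat, map_ofNat, pow_one, sub_zero, zero_mul, zero_add, add_zero, mul_one, one_mul, mul_zero]
    simp
    try simp only [C_two_eq]
    ring

open Polynomial in
lemma leg_i (n : ℕ) : derivative (legPoly (n + 1)) =
    X * derivative (legPoly n) + ((n : ℝ[X]) + 1) * legPoly n := by
  unfold legPoly
  rw [← Function.iterate_succ_apply' derivative, Function.iterate_succ_apply, rodU_deriv, iter_X_mul,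
    Function.iterate_succ_apply']

open Polynomial in
lemma leg_iv (n : ℕ) : ((n : ℝ[X]) + 1) * legPoly (n + 1) =
    ((n : ℝ[X]) + 1) * X * legPoly n + (X ^ 2 - 1) * derivative (legPoly n) := by
  have h1 : legPoly (n + 1) = derivative^[n] (X * rodU n) := by
    unfold legPoly
    rw [Function.iterate_succ_apply, rodU_deriv]
  rw [h1]
  cases n with
  | zero => simp [legPoly, rodU]
  | succ n =>
    rw [iter_X_mul]
    have h2 : (X ^ 2 - 1) * derivative (legPoly (n + 1)) =
        ((n : ℝ[X]) + 1) * ((n : ℝ[X]) + 2) * derivative^[n] (rodU (n + 1)) := by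
      have h3 := congrArg (derivative^[n + 1]) (rodU_ode (n + 1))
      have h4 : 2 * ((n + 1 : ℕ) : ℝ[X]) * X * rodU (n + 1) =
          C (2 * ((n : ℝ) + 1)) * (X * rodU (n + 1)) := by
        simp
        try simp only [C_two_eq]
        ring
      rw [h4, iterate_derivative_C_mul, iter_X_mul] at h3
      cases n with
      | zero =>
        simp [derivative_mul] at h3
        simp only [C_two_eq] at h3
        simp [legPoly]
        linear_combination h3
      | succ n =>
        rw [iter_W_mul] at h3
        unfold legPoly
        simp only [← Function.iterate_succ_apply' (derivative (R := ℝ)), ← Function.iterate_succ_apply (derivative (R := ℝ))] at h3 ⊢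
        simp only [map_mul, map_add, map_natCast, map_ofNat, map_one] at h3
        push_cast at h3 ⊢
        linear_combination h3
    rw [h2]
    unfold legPoly
    push_cast
    ring

open Polynomial in
lemma leg_ii (n : ℕ) : X * derivative (legPoly (n + 1)) - ((n : ℝ[X]) + 1) * legPoly (n + 1) =
    derivative (legPoly n) := by
  rw [leg_i, leg_iv]; ring

open Polynomial in
lemma leg_iii (n : ℕ) : (1 - X ^ 2) * derivative (legPoly (n + 1)) +
    ((n : ℝ[X]) + 1) * X * legPoly (n + 1) = ((n : ℝ[X]) + 1) * legPoly n := by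
  linear_combination (1 - X ^ 2) * leg_i n + X * leg_iv n

open Polynomial in
lemma leg_ode (n : ℕ) : (1 - X ^ 2) * derivative (derivative (legPoly n)) =
    2 * X * derivative (legPoly n) - (n : ℝ[X]) * ((n : ℝ[X]) + 1) * legPoly n := by
  have h := congrArg derivative (leg_iv n)
  simp only [derivative_add, derivative_sub, derivative_mul, derivative_X, derivative_X_pow, derivative_natCast,
      derivative_one] at h
  simp at h
  simp only [C_two_eq] at h
  linear_combination h - ((n : ℝ[X]) + 1) * leg_i n

open Polynomial in
lemma legF1 (n m : ℕ) : derivative^[m + 1] (legPoly (n + 1)) =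
    X * derivative^[m + 1] (legPoly n) + ((n : ℝ[X]) + 1 + (m : ℝ[X])) * derivative^[m] (legPoly n) := by
  induction m with
  | zero => simpa using leg_i n
  | succ m ih =>
    rw [Function.iterate_succ_apply', ih]
    simp only [derivative_add, derivative_mul, derivative_X, derivative_natCast, derivative_one,
      ← Function.iterate_succ_apply' (derivative (R := ℝ))]
    push_cast
    ring

open Polynomial in
lemma legF2 (n m : ℕ) : derivative^[m + 1] (legPoly n) =
    X * derivative^[m + 1] (legPoly (n + 1)) -
      ((n : ℝ[X]) + 1 - (m : ℝ[X])) * derivative^[m] (legPoly (n + 1)) := by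
  induction m with
  | zero => simpa using (leg_ii n).symm
  | succ m ih =>
    rw [Function.iterate_succ_apply', ih]
    simp only [derivative_add, derivative_sub, derivative_mul, derivative_X, derivative_natCast, derivative_one,
      ← Function.iterate_succ_apply' (derivative (R := ℝ))]
    push_cast
    ring

open Polynomial in
lemma legF3 (n m : ℕ) : (1 - X ^ 2) * derivative^[m + 2] (legPoly n) =
    2 * ((m : ℝ[X]) + 1) * X * derivative^[m + 1] (legPoly n) -
      ((n : ℝ[X]) - (m : ℝ[X])) * ((n : ℝ[X]) + (m : ℝ[X]) + 1) * derivative^[m] (legPoly n) := by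
  induction m with
  | zero => simpa using leg_ode n
  | succ m ih =>
    have h := congrArg derivative ih
    simp only [derivative_add, derivative_sub, derivative_mul, derivative_X, derivative_X_pow, derivative_natCast,
      derivative_one, derivative_ofNat, ← Function.iterate_succ_apply' (derivative (R := ℝ))] at h
    simp at h
    simp only [C_two_eq] at h
    push_cast
    simp only [iter_comm, Function.iterate_succ_apply'] at h ⊢
    linear_combination h

open Polynomial in
lemma legF4 (n m : ℕ) : ((n : ℝ[X]) + (m : ℝ[X]) + 1) * derivative^[m] (legPoly n) =
    (1 - X ^ 2) * derivative^[m + 1] (legPoly (n + 1)) +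
      ((n : ℝ[X]) + 1 - (m : ℝ[X])) * X * derivative^[m] (legPoly (n + 1)) := by
  induction m with
  | zero => simpa using (leg_iii n).symm
  | succ m ih =>
    have h := congrArg derivative ih
    have h2 := legF2 n m
    simp only [derivative_add, derivative_sub, derivative_mul, derivative_X, derivative_X_pow, derivative_natCast,
      derivative_one] at h
    simp at h
    simp only [C_two_eq] at h
    push_cast
    simp only [iter_comm, Function.iterate_succ_apply'] at h h2 ⊢
    linear_combination h + h2

open Polynomial in
lemma legF5 (n m : ℕ) : ((n : ℝ[X]) + 1 - (m : ℝ[X])) * derivative^[m] (legPoly (n + 1)) =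
    ((n : ℝ[X]) + (m : ℝ[X]) + 1) * X * derivative^[m] (legPoly n) -
      (1 - X ^ 2) * derivative^[m + 1] (legPoly n) := by
  induction m with
  | zero => simp; linear_combination leg_iv n
  | succ m ih =>
    have h := congrArg derivative ih
    have h2 := legF1 n m
    simp only [derivative_add, derivative_sub, derivative_mul, derivative_X, derivative_X_pow, derivative_natCast,
      derivative_one] at h
    simp at h
    simp only [C_two_eq] at h
    push_cast
    simp only [iter_comm, Function.iterate_succ_apply'] at h h2 ⊢
    linear_combination h - h2

open Polynomial in
lemma legPoly_natDegree (n : ℕ) : (legPoly n).natDegree ≤ n := by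
  have h1 : (rodU n).natDegree ≤ 2 * n := by
    unfold rodU
    refine (natDegree_C_mul_le _ _).trans ?_
    refine natDegree_pow_le.trans ?_
    have : ((X : ℝ[X]) ^ 2 - 1).natDegree ≤ 2 := by compute_degree
    nlinarith
  have := natDegree_iterate_derivative (rodU n) n
  unfold legPoly
  omega

open Polynomial in
lemma iteratedDeriv_poly (p : ℝ[X]) (n : ℕ) :
    iteratedDeriv n (fun x : ℝ => p.eval x) = fun x => (derivative^[n] p).eval x := by
  induction n with
  | zero => simp
  | succ n ih =>
    rw [iteratedDeriv_succ, ih]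
    funext x
    rw [Function.iterate_succ_apply']
    simp

open Polynomial in
lemma legendreP_eq (n : ℕ) : legendreP n = fun x => (legPoly n).eval x := by
  funext x
  unfold legendreP legPoly rodU
  rw [iterate_derivative_C_mul]
  have : (fun x : ℝ => (x ^ 2 - 1) ^ n) = fun x => (((X : ℝ[X]) ^ 2 - 1) ^ n).eval x := by
    funext x; simp
  rw [this, iteratedDeriv_poly]
  simp

open Polynomial in
/-- Value of the `m`-th derivative of the Legendre polynomial. -/
noncomputable def legQ (n m : ℕ) (z : ℝ) : ℝ := (derivative^[m] (legPoly n)).eval z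

lemma legQ_F1 (n m : ℕ) (z : ℝ) : legQ (n + 1) (m + 1) z =
    z * legQ n (m + 1) z + ((n : ℝ) + 1 + m) * legQ n m z := by
  simpa [legQ] using congrArg (Polynomial.eval z) (legF1 n m)

lemma legQ_F2 (n m : ℕ) (z : ℝ) : legQ n (m + 1) z =
    z * legQ (n + 1) (m + 1) z - ((n : ℝ) + 1 - m) * legQ (n + 1) m z := by
  simpa [legQ] using congrArg (Polynomial.eval z) (legF2 n m)

lemma legQ_F3 (n m : ℕ) (z : ℝ) : (1 - z ^ 2) * legQ n (m + 2) z =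
    2 * ((m : ℝ) + 1) * z * legQ n (m + 1) z - ((n : ℝ) - m) * ((n : ℝ) + m + 1) * legQ n m z := by
  simpa [legQ] using congrArg (Polynomial.eval z) (legF3 n m)

lemma legQ_F4 (n m : ℕ) (z : ℝ) : ((n : ℝ) + m + 1) * legQ n m z =
    (1 - z ^ 2) * legQ (n + 1) (m + 1) z + ((n : ℝ) + 1 - m) * z * legQ (n + 1) m z := by
  simpa [legQ] using congrArg (Polynomial.eval z) (legF4 n m)

lemma legQ_F5 (n m : ℕ) (z : ℝ) : ((n : ℝ) + 1 - m) * legQ (n + 1) m z =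
    ((n : ℝ) + m + 1) * z * legQ n m z - (1 - z ^ 2) * legQ n (m + 1) z := by
  simpa [legQ] using congrArg (Polynomial.eval z) (legF5 n m)

lemma legQ_zero {n m : ℕ} (h : n < m) (z : ℝ) : legQ n m z = 0 := by
  unfold legQ
  rw [Polynomial.iterate_derivative_eq_zero (lt_of_le_of_lt (legPoly_natDegree n) h)]
  simp

lemma legQ_hasDerivAt (n m : ℕ) (z : ℝ) : HasDerivAt (legQ n m) (legQ n (m + 1) z) z := by
  unfold legQ
  rw [Function.iterate_succ_apply']
  exact Polynomial.hasDerivAt _ z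

lemma assocNat_eq (n m : ℕ) : assocLegendreNat n m =
    fun z => (-1 : ℝ) ^ m * (1 - z ^ 2) ^ ((m : ℝ) / 2) * legQ n m z := by
  funext z
  unfold assocLegendreNat
  rw [legendreP_eq, iteratedDeriv_poly]
  rfl

lemma rpow_half_eq {s z : ℝ} (hs : 0 < s) (hsz : s ^ 2 = 1 - z ^ 2) (m : ℕ) :
    (1 - z ^ 2) ^ ((m : ℝ) / 2) = s ^ m := by
  rw [← hsz, ← Real.rpow_natCast s 2, ← Real.rpow_mul hs.le, ← Real.rpow_natCast s m]
  congr 1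
  push_cast
  ring

lemma assocNat_val {s z : ℝ} (hs : 0 < s) (hsz : s ^ 2 = 1 - z ^ 2) (n m : ℕ) :
    assocLegendreNat n m z = (-1 : ℝ) ^ m * s ^ m * legQ n m z := by
  rw [assocNat_eq]
  simp only [rpow_half_eq hs hsz]

lemma assocNat_zero {n m : ℕ} (h : n < m) (z : ℝ) : assocLegendreNat n m z = 0 := by
  rw [assocNat_eq]
  simp only [legQ_zero h, mul_zero]

/-- Derivative of the associated Legendre function. -/
noncomputable def assocD (n m : ℕ) (z s : ℝ) : ℝ :=
  (-1 : ℝ) ^ m * (s ^ m * legQ n (m + 1) z - m * z * s ^ m * (1 / s) ^ 2 * legQ n m z)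

lemma assocNat_hasDerivAt {s z : ℝ} (hs : 0 < s) (hsz : s ^ 2 = 1 - z ^ 2) (n m : ℕ) :
    HasDerivAt (assocLegendreNat n m) (assocD n m z s) z := by
  rw [assocNat_eq]
  have hw : 1 - z ^ 2 ≠ 0 := by rw [← hsz]; positivity
  have h1 : HasDerivAt (fun z : ℝ => 1 - z ^ 2) (-(2 * z)) z := by
    have := (hasDerivAt_pow 2 z).const_sub 1
    simpa using this
  have h2 := h1.rpow_const (p := (m : ℝ) / 2) (Or.inl hw)
  have h3 := (h2.const_mul ((-1 : ℝ) ^ m)).mul (legQ_hasDerivAt n m z)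
  refine h3.congr_deriv ?_
  rw [Real.rpow_sub_one hw, rpow_half_eq hs hsz, ← hsz]
  unfold assocD
  field_simp
  ring

/-- The four recurrences used below. -/
def RecProp (n m : ℤ) (z s P' : ℝ) : Prop :=
  ((n : ℝ) * s * assocLegendre n m z - z * s * P' - (m : ℝ) * (1 / s) * assocLegendre n m z =
    assocLegendre (n - 1) (m + 1) z) ∧
  ((n : ℝ) * s * assocLegendre n m z - z * s * P' + (m : ℝ) * (1 / s) * assocLegendre n m z =
    -(((n : ℝ) + m) * ((n : ℝ) + m - 1)) * assocLegendre (n - 1) (m - 1) z) ∧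
  (-((n : ℝ) + 1) * s * assocLegendre n m z - z * s * P' - (m : ℝ) * (1 / s) * assocLegendre n m z =
    assocLegendre (n + 1) (m + 1) z) ∧
  (-((n : ℝ) + 1) * s * assocLegendre n m z - z * s * P' + (m : ℝ) * (1 / s) * assocLegendre n m z =
    -(((n : ℝ) - m + 2) * ((n : ℝ) - m + 1)) * assocLegendre (n + 1) (m - 1) z)

lemma assoc_nat (n m : ℕ) : assocLegendre (n : ℤ) (m : ℤ) = assocLegendreNat n m := by
  funext z
  unfold assocLegendre
  by_cases h : m ≤ n
  · rw [if_pos ⟨by positivity, by rw [abs_of_nonneg (by positivity)]; exact_mod_cast h⟩,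
      if_pos (by positivity)]
    simp
  · rw [if_neg, assocNat_zero (by omega)]
    rintro ⟨_, h2⟩
    rw [abs_of_nonneg (by positivity)] at h2
    omega

lemma assoc_neg_nat {n m : ℕ} (h : m ≤ n) (z : ℝ) : assocLegendre (n : ℤ) (-(m : ℤ)) z =
    (-1 : ℝ) ^ m * ((Nat.factorial (n - m) : ℝ) / (Nat.factorial (n + m) : ℝ)) *
      assocLegendreNat n m z := by
  rcases Nat.eq_zero_or_pos m with rfl | hm
  · have := congrFun (assoc_nat n 0) z
    simp at this
    have hf : (Nat.factorial n : ℝ) ≠ 0 := by positivity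
    simp [this, hf]
  · unfold assocLegendre
    rw [if_pos ⟨by positivity, by rw [abs_neg, abs_of_nonneg (by positivity)]; exact_mod_cast h⟩,
      if_neg (by omega)]
    have e1 : ((n : ℤ) + -(m : ℤ)).toNat = n - m := by omega
    have e2 : ((n : ℤ) - -(m : ℤ)).toNat = n + m := by omega
    rw [e1, e2]
    simp

lemma assoc_out {n m : ℤ} (h : ¬ (0 ≤ n ∧ |m| ≤ n)) (z : ℝ) : assocLegendre n m z = 0 := by
  unfold assocLegendre
  rw [if_neg h]

lemma key_neg {s z : ℝ} (hs : 0 < s) (hsz : s ^ 2 = 1 - z ^ 2) :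
    z ^ 2 * s * (1 / s) ^ 2 - 1 / s = -s := by
  have : z ^ 2 = 1 - s ^ 2 := by linarith
  rw [this]; field_simp; ring

lemma recA {s z : ℝ} (hs : 0 < s) (hsz : s ^ 2 = 1 - z ^ 2) (n m : ℕ) :
    ((n : ℝ) + 1) * s * assocLegendreNat (n + 1) m z - z * s * assocD (n + 1) m z s
      - (m : ℝ) * (1 / s) * assocLegendreNat (n + 1) m z = assocLegendreNat n (m + 1) z := by
  rw [assocNat_val hs hsz, assocNat_val hs hsz, assocD]
  have key := key_neg hs hsz
  generalize 1 / s = i at *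
  have F := legQ_F2 n m z
  rw [pow_succ, pow_succ]
  linear_combination (-1 : ℝ) ^ m * s ^ m * s * F + m * (-1 : ℝ) ^ m * s ^ m * legQ (n + 1) m z * key

lemma recC {s z : ℝ} (hs : 0 < s) (hsz : s ^ 2 = 1 - z ^ 2) (n m : ℕ) :
    -((n : ℝ) + 1) * s * assocLegendreNat n m z - z * s * assocD n m z s
      - (m : ℝ) * (1 / s) * assocLegendreNat n m z = assocLegendreNat (n + 1) (m + 1) z := by
  rw [assocNat_val hs hsz, assocNat_val hs hsz, assocD]
  have key := key_neg hs hsz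
  generalize 1 / s = i at *
  have F := legQ_F1 n m z
  rw [pow_succ, pow_succ]
  linear_combination (-1 : ℝ) ^ m * s ^ m * s * F + m * (-1 : ℝ) ^ m * s ^ m * legQ n m z * key

lemma recB {s z : ℝ} (hs : 0 < s) (hsz : s ^ 2 = 1 - z ^ 2) (n b : ℕ) :
    ((n : ℝ) + 1) * s * assocLegendreNat (n + 1) (b + 1) z - z * s * assocD (n + 1) (b + 1) z s
      + ((b : ℝ) + 1) * (1 / s) * assocLegendreNat (n + 1) (b + 1) z =
      -(((n : ℝ) + b + 2) * ((n : ℝ) + b + 1)) * assocLegendreNat n b z := by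
  rw [assocNat_val hs hsz, assocNat_val hs hsz, assocD]
  have key := key_neg hs hsz
  have hi : s * (1 / s) = 1 := by field_simp
  generalize 1 / s = i at *
  have F3 := legQ_F3 (n + 1) b z
  have F4 := legQ_F4 n b z
  have h : (((n : ℝ) + 1) * s ^ 2 + 2 * (b + 1) - (b + 1) * s ^ 2) * legQ (n + 1) (b + 1) z
      - z * s ^ 2 * legQ (n + 1) (b + 2) z =
      ((n : ℝ) + b + 2) * ((n : ℝ) + b + 1) * legQ n b z := by
    rw [hsz]
    push_cast at F3
    linear_combination (-z) * F3 - ((n : ℝ) + b + 2) * F4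
  rw [pow_succ, pow_succ]
  push_cast
  linear_combination (-1 : ℝ) ^ b * s ^ b * (-h) -
    (b + 1) * (-1 : ℝ) ^ b * s ^ b * s * legQ (n + 1) (b + 1) z * key -
    2 * (b + 1) * (-1 : ℝ) ^ b * s ^ b * legQ (n + 1) (b + 1) z * hi

lemma recD {s z : ℝ} (hs : 0 < s) (hsz : s ^ 2 = 1 - z ^ 2) (n b : ℕ) :
    -((n : ℝ) + 1) * s * assocLegendreNat n (b + 1) z - z * s * assocD n (b + 1) z s
      + ((b : ℝ) + 1) * (1 / s) * assocLegendreNat n (b + 1) z =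
      -(((n : ℝ) - b + 1) * ((n : ℝ) - b)) * assocLegendreNat (n + 1) b z := by
  rw [assocNat_val hs hsz, assocNat_val hs hsz, assocD]
  have key := key_neg hs hsz
  have hi : s * (1 / s) = 1 := by field_simp
  generalize 1 / s = i at *
  have F3 := legQ_F3 n b z
  have F5 := legQ_F5 n b z
  have h : (-((n : ℝ) + 1) * s ^ 2 + 2 * (b + 1) - (b + 1) * s ^ 2) * legQ n (b + 1) z
      - z * s ^ 2 * legQ n (b + 2) z =
      ((n : ℝ) - b + 1) * ((n : ℝ) - b) * legQ (n + 1) b z := by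
    rw [hsz]
    linear_combination (-z) * F3 - ((n : ℝ) - b) * F5
  rw [pow_succ, pow_succ]
  push_cast
  linear_combination (-1 : ℝ) ^ b * s ^ b * (-h) -
    (b + 1) * (-1 : ℝ) ^ b * s ^ b * s * legQ n (b + 1) z * key -
    2 * (b + 1) * (-1 : ℝ) ^ b * s ^ b * legQ n (b + 1) z * hi

lemma legQ_one_zero (z : ℝ) : legQ 0 0 z = 1 := by
  simp [legQ, legPoly, rodU]

lemma fact_two (n : ℕ) : (Nat.factorial (n + 2) : ℝ) = (n + 2) * (n + 1) * (Nat.factorial n : ℝ) := by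
  rw [Nat.factorial_succ, Nat.factorial_succ]; push_cast; ring

lemma rec_nonneg {s z : ℝ} (hs : 0 < s) (hsz : s ^ 2 = 1 - z ^ 2) {n m : ℕ} (h : m ≤ n) :
    RecProp n m z s (assocD n m z s) := by
  have hC := recC hs hsz n m
  have up : ∀ a b : ℕ, assocLegendre ((a : ℤ)) ((b : ℤ) + 1) z = assocLegendreNat a (b + 1) z := by
    intro a b
    have := congrFun (assoc_nat a (b + 1)) z
    push_cast at this
    exact this
  have upC : assocLegendre ((n : ℤ) + 1) ((m : ℤ) + 1) z = assocLegendreNat (n + 1) (m + 1) z := by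
    have := up (n + 1) m
    push_cast at this
    exact this
  have hA : (n : ℝ) * s * assocLegendre n m z - z * s * assocD n m z s
      - (m : ℝ) * (1 / s) * assocLegendre n m z = assocLegendre ((n : ℤ) - 1) ((m : ℤ) + 1) z := by
    rw [assoc_nat]
    cases n with
    | zero =>
      obtain rfl : m = 0 := by omega
      rw [assoc_out (by simp)]
      simp [assocD, legQ_zero]
    | succ n =>
      have := up n m
      push_cast
      rw [add_sub_cancel_right, this]
      exact recA hs hsz n m
  refine ⟨by simpa using hA, ?_, ?_, ?_⟩
  · cases m with
    | zero =>
      have hA' := hA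
      simp only [Nat.cast_zero, Int.cast_zero, zero_mul, sub_zero, add_zero, zero_add, Int.cast_natCast, zero_sub] at hA' ⊢
      rw [hA']
      rcases n with _ | n
      · rw [assoc_out (by simp), assoc_out (by simp)]; simp
      · push_cast
        rw [add_sub_cancel_right]
        rcases n with _ | n
        · rw [assoc_out (by simp), assoc_out (by simp)]; simp
        · have h1 := assoc_neg_nat (n := n + 1) (m := 1) (by omega) z
          have h2 := congrFun (assoc_nat (n + 1) 1) z
          rw [← h2] at h1
          push_cast at h1 ⊢
          rw [h1]
          rw [fact_two]
          have : (Nat.factorial n : ℝ) ≠ 0 := by positivity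
          field_simp
          ring
    | succ b =>
      obtain ⟨n, rfl⟩ : ∃ k, n = k + 1 := ⟨n - 1, by omega⟩
      have hB := recB hs hsz n b
      rw [assoc_nat]
      push_cast
      rw [add_sub_cancel_right, add_sub_cancel_right, assoc_nat, hB]
      ring
  · rw [upC, ← hC, assoc_nat]; push_cast; ring
  · cases m with
    | zero =>
      simp only [Nat.cast_zero, Int.cast_zero, zero_mul, sub_zero, add_zero, zero_add, Int.cast_natCast, zero_sub] at hC ⊢
      have h0 := congrFun (assoc_nat n 0) z
      simp only [Nat.cast_zero] at h0
      rw [h0, hC]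
      have h1 := assoc_neg_nat (n := n + 1) (m := 1) (by omega) z
      push_cast at h1 ⊢
      rw [h1]
      rw [fact_two]
      have : (Nat.factorial n : ℝ) ≠ 0 := by positivity
      field_simp
    | succ b =>
      have hD := recD hs hsz n b
      have h1 := congrFun (assoc_nat (n + 1) b) z
      rw [assoc_nat]
      push_cast at h1 ⊢
      rw [add_sub_cancel_right, h1, hD]
      ring

lemma rec_neg {s z : ℝ} (hs : 0 < s) (hsz : s ^ 2 = 1 - z ^ 2) {n b : ℕ} (h : b + 1 ≤ n) :
    RecProp n (-((b + 1 : ℕ) : ℤ)) z s ((-1 : ℝ) ^ (b + 1) *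
      ((Nat.factorial (n - (b + 1)) : ℝ) / (Nat.factorial (n + (b + 1)) : ℝ)) * assocD n (b + 1) z s) := by
  obtain ⟨c, rfl⟩ : ∃ c, n = c + (b + 1) := ⟨n - (b + 1), by omega⟩
  obtain ⟨hA, hB, hC, hD⟩ := rec_nonneg hs hsz h
  have e0 := assoc_neg_nat h z
  have hcast : ((c + (b + 1) : ℕ) : ℤ) - 1 = ((c + b : ℕ) : ℤ) := by push_cast; ring
  have hcast' : ((c + (b + 1) : ℕ) : ℤ) + 1 = ((c + b + 2 : ℕ) : ℤ) := by push_cast; ring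
  have m1 : -((b + 1 : ℕ) : ℤ) + 1 = -((b : ℕ) : ℤ) := by push_cast; ring
  have m2 : -((b + 1 : ℕ) : ℤ) - 1 = -((b + 2 : ℕ) : ℤ) := by push_cast; ring
  have m3 : ((b + 1 : ℕ) : ℤ) + 1 = ((b + 2 : ℕ) : ℤ) := by push_cast; ring
  have m4 : ((b + 1 : ℕ) : ℤ) - 1 = ((b : ℕ) : ℤ) := by push_cast; ring
  have f1 : (Nat.factorial (c + (b + 1) + (b + 1)) : ℝ) =
      (c + 2 * b + 2) * (c + 2 * b + 1) * (Nat.factorial (c + 2 * b) : ℝ) := by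
    rw [show c + (b + 1) + (b + 1) = (c + 2 * b) + 2 by ring, fact_two]; push_cast; ring
  have f2 : (Nat.factorial (c + b + 2 + (b + 2)) : ℝ) = (c + 2 * b + 4) * (c + 2 * b + 3) *
      ((c + 2 * b + 2) * (c + 2 * b + 1) * (Nat.factorial (c + 2 * b) : ℝ)) := by
    rw [show c + b + 2 + (b + 2) = (c + 2 * b) + 2 + 2 by ring, fact_two, fact_two]; push_cast; ring
  have pf : (Nat.factorial (c + 2 * b) : ℝ) ≠ 0 := by positivity
  have pc : (Nat.factorial c : ℝ) ≠ 0 := by positivity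
  have p1 : ((c : ℝ) + 2 * b + 1) ≠ 0 := by positivity
  have p2 : ((c : ℝ) + 2 * b + 2) ≠ 0 := by positivity
  have p3 : ((c : ℝ) + 2 * b + 3) ≠ 0 := by positivity
  have p4 : ((c : ℝ) + 2 * b + 4) ≠ 0 := by positivity
  have g1 := assoc_neg_nat (n := c + b) (m := b) (by omega) z
  have g3 := assoc_neg_nat (n := c + b + 2) (m := b) (by omega) z
  have g4 := assoc_neg_nat (n := c + b + 2) (m := b + 2) (by omega) z
  rw [show c + b - b = c by omega, show c + b + b = c + 2 * b by omega] at g1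
  rw [show c + b + 2 - b = c + 2 by omega, show c + b + 2 + b = c + 2 * b + 2 by omega, fact_two, fact_two] at g3
  rw [show c + b + 2 - (b + 2) = c by omega, f2] at g4
  rw [hcast, assoc_nat, m3, assoc_nat] at hA
  rw [hcast, assoc_nat, m4, assoc_nat] at hB
  rw [hcast', assoc_nat, m3, assoc_nat] at hC
  rw [hcast', assoc_nat, m4, assoc_nat] at hD
  rw [show c + (b + 1) - (b + 1) = c by omega, f1] at e0
  unfold RecProp
  rw [e0, hcast, hcast', m1, m2, show c + (b + 1) - (b + 1) = c by omega, f1]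
  push_cast at hA hB hC hD g1 g3 g4 ⊢
  set P := assocLegendreNat (c + (b + 1)) (b + 1) z
  set P' := assocD (c + (b + 1)) (b + 1) z s
  set K : ℝ := (-1 : ℝ) ^ (b + 1) * ((Nat.factorial c : ℝ) / ((c + 2 * b + 2) * (c + 2 * b + 1) * (Nat.factorial (c + 2 * b) : ℝ))) with hK
  refine ⟨?_, ?_, ?_, ?_⟩
  · rw [g1]
    trans K * (-((c + (b + 1) + (b + 1)) * (c + (b + 1) + (b + 1) - 1)) * assocLegendreNat (c + b) b z)
    · rw [← hB]; ring
    · rw [hK]; field_simp; ring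
  · trans K * assocLegendreNat (c + b) (b + 2) z
    · rw [← hA]; ring
    · rcases Nat.lt_or_ge c 2 with hc | hc
      · rw [assocNat_zero (by omega)]
        have : (c : ℝ) * (c - 1) = 0 := by
          interval_cases c <;> simp
        linear_combination this * assocLegendre (↑c + ↑b) (-(↑b + 2)) z
      · obtain ⟨a, rfl⟩ : ∃ a, c = a + 2 := ⟨c - 2, by omega⟩
        have g2 := assoc_neg_nat (n := a + 2 + b) (m := b + 2) (by omega) z
        rw [show a + 2 + b - (b + 2) = a by omega, show a + 2 + b + (b + 2) = a + 2 + 2 * b + 2 by omega, fact_two (a + 2 + 2 * b)] at g2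
        push_cast at g2 p1 p2 ⊢
        rw [g2, hK, fact_two a]
        push_cast
        field_simp
        ring
  · rw [g3]
    trans K * (-((c + (b + 1) - (b + 1) + 2) * (c + (b + 1) - (b + 1) + 1)) * assocLegendreNat (c + b + 2) b z)
    · rw [← hD]; ring
    · rw [hK]; push_cast; field_simp; ring
  · rw [g4]
    trans K * assocLegendreNat (c + b + 2) (b + 2) z
    · rw [← hC]; ring
    · rw [hK]; field_simp; ring

lemma assoc_rec {s z : ℝ} (hs : 0 < s) (hsz : s ^ 2 = 1 - z ^ 2) {n m : ℤ} (hn : 0 ≤ n)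
    (hm : |m| ≤ n) : ∃ P', HasDerivAt (assocLegendre n m) P' z ∧ RecProp n m z s P' := by
  obtain ⟨n, rfl⟩ := Int.eq_ofNat_of_zero_le hn
  rw [abs_le] at hm
  rcases le_or_gt 0 m with h | h
  · obtain ⟨m, rfl⟩ := Int.eq_ofNat_of_zero_le h
    refine ⟨_, ?_, rec_nonneg hs hsz (by omega)⟩
    rw [assoc_nat]
    exact assocNat_hasDerivAt hs hsz n m
  · obtain ⟨b, rfl⟩ : ∃ b : ℕ, m = -((b + 1 : ℕ) : ℤ) := ⟨(-m - 1).toNat, by omega⟩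
    have hb : b + 1 ≤ n := by omega
    refine ⟨_, ?_, rec_neg hs hsz hb⟩
    have : assocLegendre (n : ℤ) (-((b + 1 : ℕ) : ℤ)) = fun z => (-1 : ℝ) ^ (b + 1) *
      ((Nat.factorial (n - (b + 1)) : ℝ) / (Nat.factorial (n + (b + 1)) : ℝ)) *
      assocLegendreNat n (b + 1) z := by
      funext z
      exact assoc_neg_nat hb z
    rw [this]
    exact (assocNat_hasDerivAt hs hsz n (b + 1)).const_mul _

lemma sqrt_comb {X Y Z t u : ℝ} (hX : 0 ≤ X) (hY : 0 ≤ Y) (ht : 0 ≤ t) (hu : 0 ≤ u)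
    (h : X * Y * u ^ 2 = t ^ 2 * Z) :
    Real.sqrt X * Real.sqrt Y * u = t * Real.sqrt Z := by
  rw [← Real.sqrt_mul hX]
  conv_lhs => rw [← Real.sqrt_sq hu]
  conv_rhs => rw [← Real.sqrt_sq ht]
  rw [← Real.sqrt_mul (by positivity), ← Real.sqrt_mul (by positivity), h]

/-- `γ` written with `p = n - m`, `q = n + m`. -/
lemma sphGamma_eq {n m : ℤ} {p q : ℕ} (hp : n - m = p) (hq : n + m = q) :
    sphGamma n m = Real.sqrt (((p : ℝ) + q + 1) * (Nat.factorial p : ℝ) /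
      (4 * Real.pi * (Nat.factorial q : ℝ))) := by
  have h : (2 * (n : ℝ) + 1) = (p : ℝ) + q + 1 := by
    have : 2 * n = p + q := by omega
    have h2 : 2 * (n : ℝ) = p + q := by exact_mod_cast this
    rw [h2]
  unfold sphGamma
  rw [hp, hq, h]
  simp

lemma gamma_C {n m : ℤ} (hm : |m| ≤ n) :
    Real.sqrt ((((n : ℝ) + m + 2) * ((n : ℝ) + m + 1)) / ((2 * (n : ℝ) + 1) * (2 * (n : ℝ) + 3))) *
      sphGamma (n + 1) (m + 1) * (2 * (n : ℝ) + 1) = sphGamma n m := by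
  rw [abs_le] at hm
  obtain ⟨p, hp⟩ := Int.eq_ofNat_of_zero_le (show 0 ≤ n - m by omega)
  obtain ⟨q, hq⟩ := Int.eq_ofNat_of_zero_le (show 0 ≤ n + m by omega)
  have hp' : (n : ℝ) - m = p := by exact_mod_cast hp
  have hq' : (n : ℝ) + m = q := by exact_mod_cast hq
  have h2 : 2 * (n : ℝ) = p + q := by linarith
  rw [sphGamma_eq hp hq, sphGamma_eq (p := p) (q := q + 2) (by omega) (by push_cast; omega), hq', h2, fact_two]
  rw [sqrt_comb (t := 1) (by positivity) (by positivity) (by positivity) (by positivity), one_mul]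
  push_cast
  field_simp
  ring

lemma gamma_D {n m : ℤ} (hm : |m| ≤ n) :
    Real.sqrt ((((n : ℝ) - m + 2) * ((n : ℝ) - m + 1)) / ((2 * (n : ℝ) + 1) * (2 * (n : ℝ) + 3))) *
      sphGamma (n + 1) (m - 1) * (2 * (n : ℝ) + 1) =
      (((n : ℝ) - m + 2) * ((n : ℝ) - m + 1)) * sphGamma n m := by
  rw [abs_le] at hm
  obtain ⟨p, hp⟩ := Int.eq_ofNat_of_zero_le (show 0 ≤ n - m by omega)
  obtain ⟨q, hq⟩ := Int.eq_ofNat_of_zero_le (show 0 ≤ n + m by omega)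
  have hp' : (n : ℝ) - m = p := by exact_mod_cast hp
  have hq' : (n : ℝ) + m = q := by exact_mod_cast hq
  have h2 : 2 * (n : ℝ) = p + q := by linarith
  rw [sphGamma_eq hp hq, sphGamma_eq (p := p + 2) (q := q) (by push_cast; omega) (by omega), hp', h2, fact_two]
  rw [sqrt_comb (t := ((p : ℝ) + 2) * (p + 1)) (by positivity) (by positivity) (by positivity) (by positivity)]
  push_cast
  field_simp
  ring

lemma gamma_A {n m : ℤ} (hm : |m| ≤ n) (z : ℝ) :
    Real.sqrt ((((n : ℝ) - m) * ((n : ℝ) - m - 1)) / ((2 * (n : ℝ) + 1) * (2 * (n : ℝ) - 1))) *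
      sphGamma (n - 1) (m + 1) * assocLegendre (n - 1) (m + 1) z * (2 * (n : ℝ) + 1) =
      sphGamma n m * assocLegendre (n - 1) (m + 1) z := by
  by_cases h : 0 ≤ n - 1 ∧ |m + 1| ≤ n - 1
  swap
  · rw [assoc_out h]; ring
  rw [abs_le] at hm h
  obtain ⟨p, hp⟩ := Int.eq_ofNat_of_zero_le (show 0 ≤ n - m - 2 by omega)
  obtain ⟨q, hq⟩ := Int.eq_ofNat_of_zero_le (show 0 ≤ n + m by omega)
  have hp' : (n : ℝ) - m - 2 = p := by exact_mod_cast hp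
  have hq' : (n : ℝ) + m = q := by exact_mod_cast hq
  have h2 : 2 * (n : ℝ) = p + q + 2 := by linarith
  have h3 : (n : ℝ) - m = p + 2 := by linarith
  have h4 : (p : ℝ) + 2 - 1 = p + 1 := by ring
  have h5 : (p : ℝ) + q + 2 - 1 = p + q + 1 := by ring
  rw [sphGamma_eq (p := p + 2) (q := q) (by push_cast; omega) hq,
    sphGamma_eq (p := p) (q := q) (by omega) (by omega), h2, h3, h4, h5, fact_two]
  rw [mul_right_comm, sqrt_comb (t := 1) (by positivity) (by positivity) (by positivity) (by positivity), one_mul]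
  push_cast
  field_simp
  ring

lemma gamma_B {n m : ℤ} (hm : |m| ≤ n) (z : ℝ) :
    Real.sqrt ((((n : ℝ) + m) * ((n : ℝ) + m - 1)) / ((2 * (n : ℝ) + 1) * (2 * (n : ℝ) - 1))) *
      sphGamma (n - 1) (m - 1) * assocLegendre (n - 1) (m - 1) z * (2 * (n : ℝ) + 1) =
      (((n : ℝ) + m) * ((n : ℝ) + m - 1)) * sphGamma n m * assocLegendre (n - 1) (m - 1) z := by
  by_cases h : 0 ≤ n - 1 ∧ |m - 1| ≤ n - 1
  swap
  · rw [assoc_out h]; ring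
  rw [abs_le] at hm h
  obtain ⟨p, hp⟩ := Int.eq_ofNat_of_zero_le (show 0 ≤ n - m by omega)
  obtain ⟨q, hq⟩ := Int.eq_ofNat_of_zero_le (show 0 ≤ n + m - 2 by omega)
  have hp' : (n : ℝ) - m = p := by exact_mod_cast hp
  have hq' : (n : ℝ) + m - 2 = q := by exact_mod_cast hq
  have h2 : 2 * (n : ℝ) = p + q + 2 := by linarith
  have h3 : (n : ℝ) + m = q + 2 := by linarith
  have h4 : (q : ℝ) + 2 - 1 = q + 1 := by ring
  have h5 : (p : ℝ) + q + 2 - 1 = p + q + 1 := by ring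
  rw [sphGamma_eq (p := p) (q := q + 2) hp (by push_cast; omega),
    sphGamma_eq (p := p) (q := q) (by omega) (by omega), h2, h3, h4, h5, fact_two]
  rw [mul_right_comm, sqrt_comb (t := ((q : ℝ) + 2) * (q + 1)) (by positivity) (by positivity) (by positivity) (by positivity)]
  push_cast
  field_simp
  ring

/-- Explicit form of `G` away from the polar axis. -/
noncomputable def sphH (g : ℤ → ℝ → ℂ) (k : ℝ) (n m : ℤ) (y : EuclideanSpace ℝ (Fin 3)) : ℂ :=
  g n (k * ‖y‖) * ((sphGamma n m : ℂ) *
    (((y 0 : ℂ) + (y 1 : ℂ) * Complex.I) / ((‖(y 0 : ℂ) + (y 1 : ℂ) * Complex.I‖ : ℝ) : ℂ)) ^ m *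
    ((assocLegendre n m (y 2 / ‖y‖) : ℝ) : ℂ))

lemma exp_arg_zpow {w : ℂ} (hw : w ≠ 0) (m : ℤ) :
    Complex.exp (Complex.I * (m : ℂ) * (Complex.arg w : ℂ)) = (w / ((‖w‖ : ℝ) : ℂ)) ^ m := by
  have h := Complex.norm_mul_exp_arg_mul_I w
  have hn : ((‖w‖ : ℝ) : ℂ) ≠ 0 := by simpa using hw
  have h2 : w / ((‖w‖ : ℝ) : ℂ) = Complex.exp (Complex.arg w * Complex.I) := by
    rw [div_eq_iff hn, mul_comm]; exact h.symm
  rw [h2, ← Complex.exp_int_mul]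
  congr 1
  ring

lemma abs_div_norm_le (y : EuclideanSpace ℝ (Fin 3)) : |y 2 / ‖y‖| ≤ 1 := by
  rw [abs_div, abs_norm]
  apply div_le_one_of_le₀ _ (norm_nonneg _)
  simpa using PiLp.norm_apply_le y 2

lemma sphG_eq_sphH (g : ℤ → ℝ → ℂ) (k : ℝ) (n m : ℤ) (y : EuclideanSpace ℝ (Fin 3))
    (hy : (y 0 : ℂ) + (y 1 : ℂ) * Complex.I ≠ 0) : sphG g k n m y = sphH g k n m y := by
  have h := abs_le.mp (abs_div_norm_le y)
  unfold sphG sphH sphHarm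
  rw [exp_arg_zpow hy, Real.cos_arccos h.1 h.2]

lemma coord_diff (i : Fin 3) (x : EuclideanSpace ℝ (Fin 3)) :
    DifferentiableAt ℝ (fun y : EuclideanSpace ℝ (Fin 3) => y i) x :=
  (EuclideanSpace.proj (𝕜 := ℝ) i).differentiableAt

lemma ofReal_diff {f : EuclideanSpace ℝ (Fin 3) → ℝ} {x : EuclideanSpace ℝ (Fin 3)}
    (h : DifferentiableAt ℝ f x) : DifferentiableAt ℝ (fun y => ((f y : ℝ) : ℂ)) x :=
  Complex.ofRealCLM.differentiableAt.comp x h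

lemma w_diff (x : EuclideanSpace ℝ (Fin 3)) :
    DifferentiableAt ℝ (fun y : EuclideanSpace ℝ (Fin 3) => (y 0 : ℂ) + (y 1 : ℂ) * Complex.I) x :=
  (ofReal_diff (coord_diff 0 x)).add ((ofReal_diff (coord_diff 1 x)).mul_const _)

lemma sphH_diff (g : ℤ → ℝ → ℂ) {k : ℝ} (hk : 0 < k) {n m : ℤ}
    (hdiff : DifferentiableOn ℝ (g n) (Set.Ioi 0))
    (x : EuclideanSpace ℝ (Fin 3)) (hx : x ≠ 0)
    (hw : (x 0 : ℂ) + (x 1 : ℂ) * Complex.I ≠ 0)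
    (hP : DifferentiableAt ℝ (assocLegendre n m) (x 2 / ‖x‖)) :
    DifferentiableAt ℝ (sphH g k n m) x := by
  have hx' : 0 < ‖x‖ := norm_pos_iff.mpr hx
  have hN : DifferentiableAt ℝ (fun y : EuclideanSpace ℝ (Fin 3) => ‖y‖) x :=
    differentiableAt_id.norm ℝ hx
  have h1 : DifferentiableAt ℝ (fun y : EuclideanSpace ℝ (Fin 3) => g n (k * ‖y‖)) x := by
    have hg : DifferentiableAt ℝ (g n) (k * ‖x‖) :=
      hdiff.differentiableAt (Ioi_mem_nhds (by positivity))
    exact hg.comp x (f := fun y : EuclideanSpace ℝ (Fin 3) => k * ‖y‖) (hN.const_mul k)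
  have hwN := ofReal_diff ((w_diff x).norm ℝ hw)
  have hn : ((‖(x 0 : ℂ) + (x 1 : ℂ) * Complex.I‖ : ℝ) : ℂ) ≠ 0 := by
    rw [Complex.ofReal_ne_zero]; exact norm_ne_zero_iff.mpr hw
  have h2 := (w_diff x).mul (hwN.inv hn)
  have h3 : DifferentiableAt ℝ (fun y : EuclideanSpace ℝ (Fin 3) =>
      (((y 0 : ℂ) + (y 1 : ℂ) * Complex.I) /
        ((‖(y 0 : ℂ) + (y 1 : ℂ) * Complex.I‖ : ℝ) : ℂ)) ^ m) x := by
    simp only [div_eq_mul_inv]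
    have hz : DifferentiableAt ℂ (fun z : ℂ => z ^ m) (((x 0 : ℂ) + (x 1 : ℂ) * Complex.I) *
        ((‖(x 0 : ℂ) + (x 1 : ℂ) * Complex.I‖ : ℝ) : ℂ)⁻¹) :=
      differentiableAt_zpow.mpr (Or.inl (mul_ne_zero hw (inv_ne_zero hn)))
    exact (hz.restrictScalars ℝ).comp x h2
  have h4 : DifferentiableAt ℝ (fun y : EuclideanSpace ℝ (Fin 3) => y 2 / ‖y‖) x := by
    simp only [div_eq_mul_inv]
    exact (coord_diff 2 x).mul (hN.inv hx'.ne')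
  have h5 := ofReal_diff (hP.comp x (f := fun y : EuclideanSpace ℝ (Fin 3) => y 2 / ‖y‖) h4)
  exact h1.mul (((differentiableAt_const _).mul h3).mul h5)

lemma norm_line (x : EuclideanSpace ℝ (Fin 3)) (t : ℝ) :
    ‖x + t • EuclideanSpace.single (0 : Fin 3) (1 : ℝ)‖ =
      Real.sqrt ((x 0 + t) ^ 2 + x 1 ^ 2 + x 2 ^ 2) := by
  rw [EuclideanSpace.norm_eq, Fin.sum_univ_three]
  simp

lemma norm_w (a b : ℝ) : ‖(a : ℂ) + (b : ℂ) * Complex.I‖ = Real.sqrt (a ^ 2 + b ^ 2) := by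
  rw [Complex.norm_add_mul_I]

lemma sphH_line (g : ℤ → ℝ → ℂ) (k : ℝ) (n m : ℤ) (x : EuclideanSpace ℝ (Fin 3)) (t : ℝ) :
    sphH g k n m (x + t • EuclideanSpace.single (0 : Fin 3) (1 : ℝ)) =
    g n (k * Real.sqrt ((x 0 + t) ^ 2 + x 1 ^ 2 + x 2 ^ 2)) * ((sphGamma n m : ℂ) *
    ((((x 0 + t : ℝ) : ℂ) + (x 1 : ℂ) * Complex.I) /
      ((Real.sqrt ((x 0 + t) ^ 2 + x 1 ^ 2) : ℝ) : ℂ)) ^ m *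
    ((assocLegendre n m (x 2 / Real.sqrt ((x 0 + t) ^ 2 + x 1 ^ 2 + x 2 ^ 2)) : ℝ) : ℂ)) := by
  unfold sphH
  rw [norm_line, norm_w]
  simp

lemma hasDeriv_sqrt_line (a b r : ℝ) (hr : 0 < r) (h : a ^ 2 + b = r ^ 2) :
    HasDerivAt (fun t : ℝ => Real.sqrt ((a + t) ^ 2 + b)) (a / r) 0 := by
  have h1 : HasDerivAt (fun t : ℝ => (a + t) ^ 2 + b) (2 * a) 0 := by
    have := (((hasDerivAt_id (0 : ℝ)).const_add a).pow 2).add_const b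
    simpa using this
  have h2 := h1.sqrt (by simp only [add_zero]; rw [h]; positivity)
  refine h2.congr_deriv ?_
  simp only [add_zero]
  rw [h, Real.sqrt_sq hr.le]
  field_simp

lemma sphH_lineDeriv (g : ℤ → ℝ → ℂ) (k : ℝ) (hk : 0 < k) (n m : ℤ)
    (hdiff : DifferentiableOn ℝ (g n) (Set.Ioi 0))
    (r c σ z s : ℝ) (hr : 0 < r) (hs : 0 < s) (hcs : c ^ 2 + σ ^ 2 = 1) (hzs : z ^ 2 + s ^ 2 = 1)
    (x : EuclideanSpace ℝ (Fin 3)) (hx0 : x 0 = r * c * s) (hx1 : x 1 = r * σ * s)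
    (hx2 : x 2 = r * z) (P' : ℝ) (hP : HasDerivAt (assocLegendre n m) P' z) :
    HasDerivAt (fun t : ℝ => sphH g k n m (x + t • EuclideanSpace.single (0 : Fin 3) (1 : ℝ)))
      ((k * c * s : ℂ) * deriv (g n) (k * r) * (sphGamma n m * ((c : ℂ) + σ * Complex.I) ^ m *
          (assocLegendre n m z : ℝ)) +
        g n (k * r) * (sphGamma n m * ((c : ℂ) + σ * Complex.I) ^ m *
          (-(Complex.I * m * σ / (r * s)) * (assocLegendre n m z : ℝ) - z * c * s / r * P'))) 0 := by
  have hR2 : x 0 ^ 2 + (x 1 ^ 2 + x 2 ^ 2) = r ^ 2 := by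
    rw [hx0, hx1, hx2]
    linear_combination r ^ 2 * s ^ 2 * hcs + r ^ 2 * hzs
  have hρ2 : x 0 ^ 2 + x 1 ^ 2 = (r * s) ^ 2 := by
    rw [hx0, hx1]
    linear_combination r ^ 2 * s ^ 2 * hcs
  have hrs : 0 < r * s := by positivity
  have dR := hasDeriv_sqrt_line (x 0) (x 1 ^ 2 + x 2 ^ 2) r hr hR2
  have dρ := hasDeriv_sqrt_line (x 0) (x 1 ^ 2) (r * s) hrs hρ2
  simp only [← add_assoc] at dR
  have R0 : Real.sqrt ((x 0 + 0) ^ 2 + x 1 ^ 2 + x 2 ^ 2) = r := by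
    rw [add_zero, add_assoc, hR2, Real.sqrt_sq hr.le]
  have ρ0 : Real.sqrt ((x 0 + 0) ^ 2 + x 1 ^ 2) = r * s := by
    rw [add_zero, hρ2, Real.sqrt_sq hrs.le]
  have hrC : (r : ℂ) ≠ 0 := by exact_mod_cast hr.ne'
  have hsC : (s : ℂ) ≠ 0 := by exact_mod_cast hs.ne'
  have hcsC : (c : ℂ) ^ 2 + (σ : ℂ) ^ 2 = 1 := by exact_mod_cast hcs
  have huv : ((c : ℂ) + σ * Complex.I) * ((c : ℂ) - σ * Complex.I) = 1 := by
    linear_combination hcsC - (σ : ℂ) ^ 2 * Complex.I_sq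
  have hu : (c : ℂ) + σ * Complex.I ≠ 0 := left_ne_zero_of_mul_eq_one huv
  -- radial factor
  have hg : HasDerivAt (g n) (deriv (g n) (k * r)) (k * r) :=
    (hdiff.differentiableAt (Ioi_mem_nhds (by positivity))).hasDerivAt
  have d1 : HasDerivAt (fun t : ℝ => g n (k * Real.sqrt ((x 0 + t) ^ 2 + x 1 ^ 2 + x 2 ^ 2)))
      ((k * c * s : ℂ) * deriv (g n) (k * r)) 0 := by
    have hg' : HasDerivAt (g n) (deriv (g n) (k * r))
      (k * Real.sqrt ((x 0 + 0) ^ 2 + x 1 ^ 2 + x 2 ^ 2)) := by rw [R0]; exact hg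
    have := hg'.scomp (0 : ℝ) (dR.const_mul k)
    refine this.congr_deriv ?_
    rw [hx0, Complex.real_smul]
    push_cast
    field_simp
  -- polar factor
  have d2 : HasDerivAt (fun t : ℝ => assocLegendre n m (x 2 / Real.sqrt ((x 0 + t) ^ 2 + x 1 ^ 2 + x 2 ^ 2)))
      (-(z * c * s / r * P')) 0 := by
    have hz : HasDerivAt (fun t : ℝ => x 2 / Real.sqrt ((x 0 + t) ^ 2 + x 1 ^ 2 + x 2 ^ 2))
        (-(z * c * s / r)) 0 := by
      have := (hasDerivAt_const (0 : ℝ) (x 2)).div dR (by rw [R0]; exact hr.ne')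
      refine this.congr_deriv ?_
      rw [R0, hx0, hx2]
      field_simp
      ring
    have z0 : x 2 / Real.sqrt ((x 0 + 0) ^ 2 + x 1 ^ 2 + x 2 ^ 2) = z := by
      rw [R0, hx2]; field_simp
    have hP' : HasDerivAt (assocLegendre n m) P' (x 2 / Real.sqrt ((x 0 + 0) ^ 2 + x 1 ^ 2 + x 2 ^ 2)) := by
      rw [z0]; exact hP
    refine (hP'.comp (0 : ℝ) hz).congr_deriv ?_
    ring
  have z0 : x 2 / Real.sqrt ((x 0 + 0) ^ 2 + x 1 ^ 2 + x 2 ^ 2) = z := by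
    rw [R0, hx2]; field_simp
  have u0 : (((x 0 + 0 : ℝ) : ℂ) + (x 1 : ℂ) * Complex.I) /
      ((Real.sqrt ((x 0 + 0) ^ 2 + x 1 ^ 2) : ℝ) : ℂ) = (c : ℂ) + σ * Complex.I := by
    rw [ρ0, hx0, hx1]
    push_cast
    field_simp
    ring
  -- azimuthal factor
  have d3 : HasDerivAt (fun t : ℝ => ((((x 0 + t : ℝ) : ℂ) + (x 1 : ℂ) * Complex.I) /
      ((Real.sqrt ((x 0 + t) ^ 2 + x 1 ^ 2) : ℝ) : ℂ)))
      (-(Complex.I * σ / (r * s)) * ((c : ℂ) + σ * Complex.I)) 0 := by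
    have hw : HasDerivAt (fun t : ℝ => (((x 0 + t : ℝ) : ℂ) + (x 1 : ℂ) * Complex.I)) 1 0 := by
      have := (((hasDerivAt_id (0 : ℝ)).const_add (x 0)).ofReal_comp).add_const ((x 1 : ℂ) * Complex.I)
      simpa using this
    have := hw.div dρ.ofReal_comp (by rw [ρ0]; exact_mod_cast hrs.ne')
    refine this.congr_deriv ?_
    rw [ρ0, hx0, hx1]
    push_cast
    field_simp
    linear_combination (-(r * s) : ℂ) * hcsC + (r * s : ℂ) * (σ : ℂ) ^ 2 * Complex.I_sq
  have d4 : HasDerivAt (fun t : ℝ => ((((x 0 + t : ℝ) : ℂ) + (x 1 : ℂ) * Complex.I) /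
      ((Real.sqrt ((x 0 + t) ^ 2 + x 1 ^ 2) : ℝ) : ℂ)) ^ m)
      (-(Complex.I * m * σ / (r * s)) * ((c : ℂ) + σ * Complex.I) ^ m) 0 := by
    have hz := hasDerivAt_zpow m ((c : ℂ) + σ * Complex.I) (Or.inl hu)
    rw [← u0] at hz
    refine ((hz.hasFDerivAt.restrictScalars ℝ).comp_hasDerivAt (0 : ℝ) d3).congr_deriv ?_
    rw [u0]
    simp
    rw [zpow_sub_one₀ hu]
    generalize (c : ℂ) + σ * Complex.I = u at hu
    field_simp
  have hfun : (fun t : ℝ => sphH g k n m (x + t • EuclideanSpace.single (0 : Fin 3) (1 : ℝ))) = _ :=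
    funext (sphH_line g k n m x)
  rw [hfun]
  refine (d1.mul ((d4.const_mul (sphGamma n m : ℂ)).mul d2.ofReal_comp)).congr_deriv ?_
  simp only [Pi.mul_apply, u0, z0]
  simp only [R0]
  push_cast
  ring

/-- `∂_{x₁} G(x) = (k/2)(g_{n-1}(kr)(a_{n-1}^{m+1} Y_{n-1}^{m+1} − b_{n-1}^{m-1} Y_{n-1}^{m-1})
+ g_{n+1}(kr)(c_{n+1}^{m+1} Y_{n+1}^{m+1} − d_{n+1}^{m-1} Y_{n+1}^{m-1}))`. -/
theorem sphG_deriv_x1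
    (g : ℤ → ℝ → ℂ)
    (hdiff : ∀ ν : ℤ, DifferentiableOn ℝ (g ν) (Set.Ioi 0))
    (hg1 : ∀ ν : ℤ, 0 ≤ ν → ∀ r : ℝ, 0 < r →
      g ν r / (r : ℂ) = (g (ν - 1) r + g (ν + 1) r) / (2 * (ν : ℂ) + 1))
    (hg2 : ∀ ν : ℤ, 0 ≤ ν → ∀ r : ℝ, 0 < r →
      deriv (g ν) r = ((ν : ℂ) * g (ν - 1) r - ((ν : ℂ) + 1) * g (ν + 1) r) / (2 * (ν : ℂ) + 1))
    (k : ℝ) (hk : 0 < k) (n m : ℤ) (hn : 0 ≤ n) (hm : |m| ≤ n)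
    (r θ φ : ℝ) (hr : 0 < r) (hθ : θ ∈ Set.Ioo (0 : ℝ) Real.pi)
    (x : EuclideanSpace ℝ (Fin 3))
    (hx0 : x 0 = r * Real.cos φ * Real.sin θ)
    (hx1 : x 1 = r * Real.sin φ * Real.sin θ)
    (hx2 : x 2 = r * Real.cos θ) :
    fderiv ℝ (sphG g k n m) x (EuclideanSpace.single 0 1) =
      ((k : ℂ) / 2) *
        (g (n - 1) (k * r) *
            (((Real.sqrt ((((n : ℝ) - m) * ((n : ℝ) - m - 1)) /
                ((2 * (n : ℝ) + 1) * (2 * (n : ℝ) - 1))) : ℝ) : ℂ) *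
                sphHarm (n - 1) (m + 1) θ φ -
              ((Real.sqrt ((((n : ℝ) + m) * ((n : ℝ) + m - 1)) /
                ((2 * (n : ℝ) + 1) * (2 * (n : ℝ) - 1))) : ℝ) : ℂ) *
                sphHarm (n - 1) (m - 1) θ φ) +
          g (n + 1) (k * r) *
            (((Real.sqrt ((((n : ℝ) + m + 2) * ((n : ℝ) + m + 1)) /
                ((2 * (n : ℝ) + 1) * (2 * (n : ℝ) + 3))) : ℝ) : ℂ) *
                sphHarm (n + 1) (m + 1) θ φ -
              ((Real.sqrt ((((n : ℝ) - m + 2) * ((n : ℝ) - m + 1)) /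
                ((2 * (n : ℝ) + 1) * (2 * (n : ℝ) + 3))) : ℝ) : ℂ) *
                sphHarm (n + 1) (m - 1) θ φ)) := by
  have hs : 0 < Real.sin θ := Real.sin_pos_of_mem_Ioo hθ
  have hcs : Real.cos φ ^ 2 + Real.sin φ ^ 2 = 1 := Real.cos_sq_add_sin_sq φ
  have hzs : Real.cos θ ^ 2 + Real.sin θ ^ 2 = 1 := Real.cos_sq_add_sin_sq θ
  obtain ⟨P', hP, hA, hB, hC, hD⟩ :=
    assoc_rec (z := Real.cos θ) hs (by linarith) hn hm
  have hkr : 0 < k * r := by positivity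
  have hnorm : ‖x‖ = r := by
    have h := norm_line x 0
    rw [zero_smul, add_zero, add_zero] at h
    rw [h, hx0, hx1, hx2, ← Real.sqrt_sq hr.le]
    congr 1
    rw [Real.sqrt_sq hr.le]
    linear_combination r ^ 2 * Real.sin θ ^ 2 * hcs + r ^ 2 * hzs
  have hw : (x 0 : ℂ) + (x 1 : ℂ) * Complex.I ≠ 0 := by
    rw [← norm_pos_iff, norm_w]
    apply Real.sqrt_pos.mpr
    have : x 0 ^ 2 + x 1 ^ 2 = (r * Real.sin θ) ^ 2 := by
      rw [hx0, hx1]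
      linear_combination r ^ 2 * Real.sin θ ^ 2 * hcs
    rw [this]
    positivity
  have hx : x ≠ 0 := by
    rw [← norm_pos_iff, hnorm]; exact hr
  have hz : x 2 / ‖x‖ = Real.cos θ := by
    rw [hnorm, hx2]; field_simp
  have hev : sphG g k n m =ᶠ[nhds x] sphH g k n m := by
    have hc := (w_diff x).continuousAt.eventually_ne hw
    filter_upwards [hc] with y hy
    exact sphG_eq_sphH g k n m y hy
  have hd : DifferentiableAt ℝ (sphH g k n m) x :=
    sphH_diff g hk (hdiff n) x hx hw (by rw [hz]; exact hP.differentiableAt)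
  have hline := sphH_lineDeriv g k hk n m (hdiff n) r (Real.cos φ) (Real.sin φ) (Real.cos θ)
    (Real.sin θ) hr hs hcs hzs x hx0 hx1 hx2 P' hP
  rw [hev.fderiv_eq, ← hd.lineDeriv_eq_fderiv, HasLineDerivAt.lineDeriv hline]
  -- exponentials
  set u : ℂ := ((Real.cos φ : ℝ) : ℂ) + ((Real.sin φ : ℝ) : ℂ) * Complex.I with hu
  set v : ℂ := ((Real.cos φ : ℝ) : ℂ) - ((Real.sin φ : ℝ) : ℂ) * Complex.I with hv
  have hue : Complex.exp (φ * Complex.I) = u := by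
    rw [hu, Complex.exp_mul_I, Complex.ofReal_cos, Complex.ofReal_sin]
  have hve : Complex.exp (-(φ * Complex.I)) = v := by
    rw [hv, ← neg_mul, Complex.exp_mul_I, Complex.ofReal_cos, Complex.ofReal_sin, Complex.cos_neg,
      Complex.sin_neg]
    ring
  have hum : Complex.exp (Complex.I * (m : ℂ) * (φ : ℂ)) = u ^ m := by
    rw [← hue, ← Complex.exp_int_mul]
    congr 1
    ring
  have hp : Complex.exp (Complex.I * ((m + 1 : ℤ) : ℂ) * (φ : ℂ)) = u ^ m * u := by
    rw [← hum, ← hue, ← Complex.exp_add]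
    congr 1
    push_cast
    ring
  have hq : Complex.exp (Complex.I * ((m - 1 : ℤ) : ℂ) * (φ : ℂ)) = u ^ m * v := by
    rw [← hum, ← hve, ← Complex.exp_add]
    congr 1
    push_cast
    ring
  have hcu : ((Real.cos φ : ℝ) : ℂ) = (u + v) / 2 := by rw [hu, hv]; ring
  have hsu : Complex.I * ((Real.sin φ : ℝ) : ℂ) = (u - v) / 2 := by rw [hu, hv]; ring
  -- Bessel recurrences
  have h1 := hg1 n hn (k * r) hkr
  have h2 := hg2 n hn (k * r) hkr
  have hL : (2 * (n : ℝ) + 1) ≠ 0 := by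
    have : (0 : ℝ) ≤ n := by exact_mod_cast hn
    positivity
  have hLC : (2 * (n : ℂ) + 1) ≠ 0 := by exact_mod_cast hL
  have hkC : (k : ℂ) ≠ 0 := by exact_mod_cast hk.ne'
  have hrC : (r : ℂ) ≠ 0 := by exact_mod_cast hr.ne'
  have hsC : ((Real.sin θ : ℝ) : ℂ) ≠ 0 := by exact_mod_cast hs.ne'
  have h1' : g n (k * r) = k * r * ((g (n - 1) (k * r) + g (n + 1) (k * r)) / (2 * (n : ℂ) + 1)) := by
    rw [← h1]
    push_cast
    field_simp
  -- coefficients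
  have gA := gamma_A hm (Real.cos θ)
  have gB := gamma_B hm (Real.cos θ)
  have gC := gamma_C hm
  have gD := gamma_D hm
  rw [h2, h1']
  unfold sphHarm
  rw [hp, hq]
  generalize hSA : Real.sqrt ((((n : ℝ) - m) * ((n : ℝ) - m - 1)) /
                ((2 * (n : ℝ) + 1) * (2 * (n : ℝ) - 1))) = SA at *
  generalize hSB : Real.sqrt ((((n : ℝ) + m) * ((n : ℝ) + m - 1)) /
                ((2 * (n : ℝ) + 1) * (2 * (n : ℝ) - 1))) = SB at *
  generalize hSC : Real.sqrt ((((n : ℝ) + m + 2) * ((n : ℝ) + m + 1)) /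
                ((2 * (n : ℝ) + 1) * (2 * (n : ℝ) + 3))) = SC at *
  generalize hSD : Real.sqrt ((((n : ℝ) - m + 2) * ((n : ℝ) - m + 1)) /
                ((2 * (n : ℝ) + 1) * (2 * (n : ℝ) + 3))) = SD at *
  have eA : SA * sphGamma (n - 1) (m + 1) * assocLegendre (n - 1) (m + 1) (Real.cos θ) *
      (2 * (n : ℝ) + 1) = sphGamma n m *
      ((n : ℝ) * Real.sin θ * assocLegendre n m (Real.cos θ) -
        Real.cos θ * Real.sin θ * P' - (m : ℝ) * (1 / Real.sin θ) * assocLegendre n m (Real.cos θ)) := by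
    rw [hA]; exact gA
  have eB : -(SB * sphGamma (n - 1) (m - 1) * assocLegendre (n - 1) (m - 1) (Real.cos θ)) *
      (2 * (n : ℝ) + 1) = sphGamma n m *
      ((n : ℝ) * Real.sin θ * assocLegendre n m (Real.cos θ) -
        Real.cos θ * Real.sin θ * P' + (m : ℝ) * (1 / Real.sin θ) * assocLegendre n m (Real.cos θ)) := by
    rw [hB]; linear_combination -gB
  have eC : SC * sphGamma (n + 1) (m + 1) * assocLegendre (n + 1) (m + 1) (Real.cos θ) *
      (2 * (n : ℝ) + 1) = sphGamma n m *
      (-((n : ℝ) + 1) * Real.sin θ * assocLegendre n m (Real.cos θ) -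
        Real.cos θ * Real.sin θ * P' - (m : ℝ) * (1 / Real.sin θ) * assocLegendre n m (Real.cos θ)) := by
    rw [hC]; linear_combination assocLegendre (n + 1) (m + 1) (Real.cos θ) * gC
  have eD : -(SD * sphGamma (n + 1) (m - 1) * assocLegendre (n + 1) (m - 1) (Real.cos θ)) *
      (2 * (n : ℝ) + 1) = sphGamma n m *
      (-((n : ℝ) + 1) * Real.sin θ * assocLegendre n m (Real.cos θ) -
        Real.cos θ * Real.sin θ * P' + (m : ℝ) * (1 / Real.sin θ) * assocLegendre n m (Real.cos θ)) := by
    rw [hD]; linear_combination -assocLegendre (n + 1) (m - 1) (Real.cos θ) * gD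
  replace eA := congrArg (fun t : ℝ => (t : ℂ)) eA
  replace eB := congrArg (fun t : ℝ => (t : ℂ)) eB
  replace eC := congrArg (fun t : ℝ => (t : ℂ)) eC
  replace eD := congrArg (fun t : ℝ => (t : ℂ)) eD
  simp only [Complex.ofReal_mul, Complex.ofReal_add, Complex.ofReal_sub, Complex.ofReal_neg,
    Complex.ofReal_div, Complex.ofReal_one, Complex.ofReal_ofNat, Complex.ofReal_intCast]
    at eA eB eC eD
  have hsin : Complex.I * (m : ℂ) * ((Real.sin φ : ℝ) : ℂ) / ((r : ℂ) * ((Real.sin θ : ℝ) : ℂ)) =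
      (m : ℂ) * ((u - v) / 2) * (1 / r) * (1 / ((Real.sin θ : ℝ) : ℂ)) := by
    rw [← hsu]; field_simp
  rw [hsin, hcu]
  clear_value u v
  generalize u ^ m = U
  generalize ((Real.sin θ : ℝ) : ℂ) = s at *
  generalize ((Real.cos θ : ℝ) : ℂ) = z at *
  generalize ((assocLegendre n m (Real.cos θ) : ℝ) : ℂ) = P at *
  generalize ((assocLegendre (n - 1) (m + 1) (Real.cos θ) : ℝ) : ℂ) = PA at *
  generalize ((assocLegendre (n - 1) (m - 1) (Real.cos θ) : ℝ) : ℂ) = PB at *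
  generalize ((assocLegendre (n + 1) (m + 1) (Real.cos θ) : ℝ) : ℂ) = PC at *
  generalize ((assocLegendre (n + 1) (m - 1) (Real.cos θ) : ℝ) : ℂ) = PD at *
  generalize g (n - 1) (k * r) = gm at *
  generalize g (n + 1) (k * r) = gp at *
  apply mul_right_cancel₀ hLC
  have hri : (r : ℂ) * (1 / r) = 1 := by field_simp
  have hsplit : ∀ a : ℂ, a / (2 * (n : ℂ) + 1) * (2 * (n : ℂ) + 1) = a := fun a => by field_simp
  have e1 := hsplit ((n : ℂ) * gm - ((n : ℂ) + 1) * gp)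
  have e2 := hsplit (gm + gp)
  generalize ((n : ℂ) * gm - ((n : ℂ) + 1) * gp) / (2 * (n : ℂ) + 1) = D1 at *
  generalize (gm + gp) / (2 * (n : ℂ) + 1) = D2 at *
  rw [div_eq_mul_one_div (z * ((u + v) / 2) * s) (r : ℂ)]
  generalize (1 : ℂ) / r = ri at *
  generalize (1 : ℂ) / s = si at *
  linear_combination (k * ((u + v) / 2) * s * sphGamma n m * U * P : ℂ) * e1 +
    (k * r * ri * sphGamma n m * U * (-(m * ((u - v) / 2) * si) * P - z * ((u + v) / 2) * s * P') : ℂ) * e2 +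
    (k * (gm + gp) * sphGamma n m * U * (-(m * ((u - v) / 2) * si) * P - z * ((u + v) / 2) * s * P') : ℂ) * hri -
    (k / 2 : ℂ) * (gm * U * u * eA + gm * U * v * eB + gp * U * u * eC + gp * U * v * eD)
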